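/- arXiv:1407.2108 — 2 statements merged into one kernel-verified Lean document; each statement's English description precedes it below -/
import Mathlib

section
/- Let f ∈ H_{n,d} be an n-variate homogeneous polynomial of degree d, and let r, m be integers with 1 ≤ r ≤ m and m ≥ d. Then f_{Δ(n,r)} − f_{Δ(n,m)} ≤ (1 − (r^{\underline{d}} m^d)/(r^d m^{\underline{d}})) · C(2d−1, d) · d^d · (\overline{f} − \underline{f}), where C(2d−1, d) is the binomial coefficient. -/
open Finset

/-- The regular grid Δ(n,r): points of the standard simplex whose coordinates are
rationals with denominator r. -/
noncomputable def gridSet (n r : ℕ) : Set (Fin n → ℝ) :=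
  {x ∈ stdSimplex ℝ (Fin n) | ∀ i, ∃ k : ℕ, (r : ℝ) * x i = (k : ℝ)}

/-- `f_{Δ(n,r)}` : the minimum of `f` over the regular grid `Δ(n,r)`. -/
noncomputable def gridMin (n r : ℕ) (f : (Fin n → ℝ) → ℝ) : ℝ := sInf (f '' gridSet n r)

/-- `\underline{f}` : the minimum of `f` over the standard simplex. -/
noncomputable def simplexMin (n : ℕ) (f : (Fin n → ℝ) → ℝ) : ℝ :=
  sInf (f '' stdSimplex ℝ (Fin n))

/-- `\overline{f}` : the maximum of `f` over the standard simplex. -/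
noncomputable def simplexMax (n : ℕ) (f : (Fin n → ℝ) → ℝ) : ℝ :=
  sSup (f '' stdSimplex ℝ (Fin n))

/-- The form of degree `d` with (not necessarily symmetric) coefficient tensor `T`. -/
def tensorForm {n d : ℕ} (T : (Fin d → Fin n) → ℝ) (x : Fin n → ℝ) : ℝ :=
  ∑ i, T i * ∏ k, x (i k)

/-- The vector counting how often each value in `Fin n` is taken by `c` on `S`. -/
def countVec {n : ℕ} {ι : Type*} (c : ι → Fin n) (S : Finset ι) (j : Fin n) : ℝ :=
  ∑ b ∈ S, if c b = j then 1 else 0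

lemma sum_countVec {n : ℕ} {ι : Type*} (c : ι → Fin n) (S : Finset ι) :
    ∑ j, countVec c S j = #S := by
  unfold countVec
  rw [sum_comm]
  simp

lemma countVec_nonneg {n : ℕ} {ι : Type*} (c : ι → Fin n) (S : Finset ι) (j : Fin n) :
    0 ≤ countVec c S j :=
  sum_nonneg fun b _ => by split_ifs <;> norm_num

lemma inv_smul_countVec_mem_gridSet {n : ℕ} {ι : Type*} (c : ι → Fin n) {S : Finset ι}
    (hS : S.Nonempty) : (#S : ℝ)⁻¹ • countVec c S ∈ gridSet n #S := by
  have h0 : (#S : ℝ) ≠ 0 := by simpa using hS.ne_empty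
  refine ⟨⟨fun j => ?_, ?_⟩, fun j => ⟨#{b ∈ S | c b = j}, ?_⟩⟩
  · exact mul_nonneg (by positivity) (countVec_nonneg c S j)
  · simp only [Pi.smul_apply, smul_eq_mul]
    rw [← mul_sum, sum_countVec, inv_mul_cancel₀ h0]
  · rw [Pi.smul_apply, smul_eq_mul, mul_inv_cancel_left₀ h0]
    simp [countVec]

lemma tensorForm_smul {n d : ℕ} (T : (Fin d → Fin n) → ℝ) (a : ℝ) (x : Fin n → ℝ) :
    tensorForm T (a • x) = a ^ d * tensorForm T x := by
  simp only [tensorForm, mul_sum, Pi.smul_apply, smul_eq_mul, prod_mul_distrib, prod_const,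
    card_univ, Fintype.card_fin]
  exact sum_congr rfl fun _ _ => by ring

lemma tensorForm_sub_const {n d : ℕ} (T : (Fin d → Fin n) → ℝ) (L : ℝ) (x : Fin n → ℝ) :
    tensorForm (fun i => T i - L) x = tensorForm T x - L * (∑ j, x j) ^ d := by
  have h := Finset.prod_univ_sum (fun _ : Fin d => (univ : Finset (Fin n))) fun _ j => x j
  simp only [prod_const, card_univ, Fintype.card_fin, Fintype.piFinset_univ] at h
  simp only [tensorForm, sub_mul, sum_sub_distrib, h, mul_sum]

lemma tensorForm_countVec {n d : ℕ} {ι : Type*} [DecidableEq ι] (T : (Fin d → Fin n) → ℝ)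
    (c : ι → Fin n) (S : Finset ι) :
    tensorForm T (countVec c S) = ∑ g ∈ Fintype.piFinset fun _ : Fin d => S, T (c ∘ g) := by
  simp only [tensorForm, countVec, prod_univ_sum, mul_sum]
  rw [sum_comm]
  refine sum_congr rfl fun g _ => ?_
  rw [sum_eq_single (c ∘ g)]
  · simp
  · intro i _ hi
    obtain ⟨k, hk⟩ := Function.ne_iff.1 hi
    rw [prod_eq_zero (mem_univ k) (if_neg fun h => hk h.symm), mul_zero]
  · simp

/-- Polarization: alternating sums of values recover the symmetrized coefficients. -/
lemma sum_neg_one_pow_mul_tensorForm_countVec {n d : ℕ} (T : (Fin d → Fin n) → ℝ)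
    (i : Fin d → Fin n) :
    ∑ U : Finset (Fin d), (-1 : ℝ) ^ #U * tensorForm T (countVec i Uᶜ) =
      ∑ σ : Equiv.Perm (Fin d), T (i ∘ σ) := by
  have key (g : Fin d → Fin d) :
      ∑ U : Finset (Fin d), (if g ∈ Fintype.piFinset (fun _ => Uᶜ) then (-1 : ℝ) ^ #U else 0) =
        if Function.Bijective g then 1 else 0 := by
    have h1 (U : Finset (Fin d)) :
        g ∈ Fintype.piFinset (fun _ => Uᶜ) ↔ U ∈ ((univ.image g)ᶜ).powerset := by
      rw [Fintype.mem_piFinset, mem_powerset, subset_compl_comm]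
      simp [subset_iff]
    simp only [h1]
    rw [← sum_filter, filter_univ_mem]
    have h2 := congrArg (Int.cast : ℤ → ℝ) (sum_powerset_neg_one_pow_card (x := (univ.image g)ᶜ))
    push_cast at h2
    rw [h2]
    refine if_congr ?_ rfl rfl
    rw [compl_eq_empty_iff, ← Finite.surjective_iff_bijective, eq_univ_iff_forall]
    simp [Function.Surjective]
  calc _ = ∑ U : Finset (Fin d), ∑ g : Fin d → Fin d,
        (if g ∈ Fintype.piFinset (fun _ => Uᶜ) then (-1 : ℝ) ^ #U else 0) * T (i ∘ g) := by
        refine sum_congr rfl fun U _ => ?_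
        rw [tensorForm_countVec, mul_sum]
        simp only [ite_mul, zero_mul]
        rw [← sum_filter, filter_univ_mem]
    _ = ∑ g : Fin d → Fin d, if Function.Bijective g then T (i ∘ g) else 0 := by
        rw [sum_comm]
        refine sum_congr rfl fun g _ => ?_
        rw [← sum_mul, key]
        simp
    _ = _ := by
        rw [← sum_filter]
        exact sum_bij (fun p h ↦ Equiv.ofBijective p (mem_filter.1 h).2) (fun _ _ ↦ mem_univ _)
          (fun _ _ _ _ h ↦ by injection h)
          (fun b _ ↦ ⟨b, mem_filter.2 ⟨mem_univ _, b.bijective⟩, Equiv.coe_fn_injective rfl⟩)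
          fun _ _ ↦ rfl

lemma two_pow_sub_one_le_factorial_mul_choose {d : ℕ} (hd : 1 ≤ d) :
    2 ^ d - 1 ≤ d.factorial * (2 * d - 1).choose d := by
  rw [← Nat.descFactorial_eq_factorial_mul_choose]
  obtain rfl | h := hd.eq_or_lt
  · simp
  · have h1 := Nat.pow_sub_le_descFactorial (2 * d - 1) d
    rw [show 2 * d - 1 + 1 - d = d by omega] at h1
    have h2 : 2 ^ d ≤ d ^ d := Nat.pow_le_pow_left h d
    omega

/-- Upper bound for the symmetrized coefficients of a form taking values in `[0, M]` on the
simplex. -/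
lemma sum_perm_le_of_nonneg_of_le {n d : ℕ} (hd : 1 ≤ d) (T : (Fin d → Fin n) → ℝ) {M : ℝ}
    (h0 : ∀ x ∈ stdSimplex ℝ (Fin n), 0 ≤ tensorForm T x)
    (hM : ∀ x ∈ stdSimplex ℝ (Fin n), tensorForm T x ≤ M) (i : Fin d → Fin n) :
    ∑ σ : Equiv.Perm (Fin d), T (i ∘ σ) ≤
      d.factorial * ((2 * d - 1).choose d * (d : ℝ) ^ d * M) := by
  have hval (S : Finset (Fin d)) (hS : S.Nonempty) :
      0 ≤ tensorForm T (countVec i S) ∧ tensorForm T (countVec i S) ≤ (d : ℝ) ^ d * M := by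
    have hmem := (inv_smul_countVec_mem_gridSet i hS).1
    have hS0 : (#S : ℝ) ≠ 0 := by simpa using hS.ne_empty
    have heq : tensorForm T (countVec i S) =
        (#S : ℝ) ^ d * tensorForm T ((#S : ℝ)⁻¹ • countVec i S) := by
      rw [← tensorForm_smul, smul_inv_smul₀ hS0]
    have hSd : (#S : ℝ) ≤ d := by exact_mod_cast (card_le_univ S).trans_eq (Fintype.card_fin d)
    rw [heq]
    refine ⟨mul_nonneg (by positivity) (h0 _ hmem), ?_⟩
    exact mul_le_mul (pow_le_pow_left₀ (by positivity) hSd d) (hM _ hmem) (h0 _ hmem)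
      (by positivity)
  have hzero : tensorForm T (countVec i ∅) = 0 := by
    refine sum_eq_zero fun g _ => ?_
    rw [prod_eq_zero (mem_univ ⟨0, hd⟩) (by simp [countVec]), mul_zero]
  have hdM : 0 ≤ (d : ℝ) ^ d * M := by
    have := hval {⟨0, hd⟩} (singleton_nonempty _)
    exact this.1.trans this.2
  rw [← sum_neg_one_pow_mul_tensorForm_countVec]
  calc _ ≤ ∑ U : Finset (Fin d), if U ≠ univ then (d : ℝ) ^ d * M else 0 := by
        refine sum_le_sum fun U _ => ?_
        split_ifs with hU
        · obtain ⟨h1, h2⟩ := hval Uᶜ (by simpa [nonempty_iff_ne_empty] using hU)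
          obtain h | h := neg_one_pow_eq_or ℝ #U <;> rw [h] <;> linarith
        · rw [not_not.1 hU, compl_univ, hzero, mul_zero]
    _ = ((2 ^ d - 1 : ℕ) : ℝ) * ((d : ℝ) ^ d * M) := by
        rw [← sum_filter, sum_const, nsmul_eq_mul, filter_ne', card_erase_of_mem (mem_univ _)]
        simp
    _ ≤ (d.factorial * (2 * d - 1).choose d : ℕ) * ((d : ℝ) ^ d * M) :=
        mul_le_mul_of_nonneg_right
          (by exact_mod_cast two_pow_sub_one_le_factorial_mul_choose hd) hdM
    _ = _ := by push_cast; ring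

lemma tensorForm_symmetrize {n d : ℕ} (T : (Fin d → Fin n) → ℝ) (x : Fin n → ℝ) :
    tensorForm (fun i => (d.factorial : ℝ)⁻¹ * ∑ σ : Equiv.Perm (Fin d), T (i ∘ σ)) x =
      tensorForm T x := by
  have h (σ : Equiv.Perm (Fin d)) :
      ∑ i : Fin d → Fin n, T (i ∘ σ) * ∏ k, x (i k) = tensorForm T x := by
    refine Fintype.sum_equiv (Equiv.arrowCongr σ.symm (Equiv.refl _)) _ _ fun i => ?_
    congr 1
    exact (Equiv.prod_comp σ fun k => x (i k)).symm
  simp only [tensorForm, mul_assoc, sum_mul]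
  rw [← mul_sum, sum_comm]
  simp only [h, sum_const, card_univ, Fintype.card_perm, Fintype.card_fin, nsmul_eq_mul]
  exact inv_mul_cancel_left₀ (by positivity) _

lemma exists_fin_map_prod_eq {n d : ℕ} (s : Fin n →₀ ℕ) (hs : s.degree = d) :
    ∃ i : Fin d → Fin n, ∀ x : Fin n → ℝ, ∏ j, x j ^ s j = ∏ k, x (i k) := by
  obtain ⟨l, hl⟩ := Quot.exists_rep (Finsupp.toMultiset s)
  have hl' : (l : Multiset (Fin n)) = Finsupp.toMultiset s := hl
  have hlen : l.length = d := by
    rw [← Multiset.coe_card, hl', Finsupp.card_toMultiset, ← hs]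
    rfl
  subst hlen
  refine ⟨l.get, fun x => ?_⟩
  have h := congrArg (fun t => (Multiset.map x t).prod) hl'
  simp only [Multiset.map_coe, Multiset.prod_coe, Finsupp.toMultiset_map,
    Finsupp.prod_toMultiset] at h
  rw [Finsupp.prod_mapDomain_index (by simp) (by intros; rw [pow_add]),
    Finsupp.prod_fintype _ _ (by simp)] at h
  rw [← h, ← Fin.prod_univ_fun_getElem]
  rfl

lemma exists_tensorForm_eq_eval {n d : ℕ} {p : MvPolynomial (Fin n) ℝ} (hp : p.IsHomogeneous d) :
    ∃ T : (Fin d → Fin n) → ℝ, ∀ x, MvPolynomial.eval x p = tensorForm T x := by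
  have h (s : p.support) : ∃ i : Fin d → Fin n,
      ∀ x : Fin n → ℝ, ∏ j, x j ^ s.1 j = ∏ k, x (i k) := by
    refine exists_fin_map_prod_eq s.1 ?_
    rw [Finsupp.degree_eq_weight_one]
    exact hp (MvPolynomial.mem_support_iff.1 s.2)
  choose e he using h
  refine ⟨fun i => ∑ s : p.support, if e s = i then p.coeff s.1 else 0, fun x => ?_⟩
  rw [MvPolynomial.eval_eq', ← sum_coe_sort]
  simp only [tensorForm, sum_mul, ite_mul, zero_mul]
  rw [sum_comm]
  simp [he]

lemma descFactorial_mul_choose_le_card_filter {ι : Type*} [Fintype ι] [DecidableEq ι] {r d : ℕ}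
    (hd : d ≤ Fintype.card ι) {t : Finset ι} (ht : #t ≤ d) :
    r.descFactorial d * (Fintype.card ι).choose r ≤
      (Fintype.card ι).descFactorial d * #{S ∈ powersetCard r (univ : Finset ι) | t ⊆ S} := by
  obtain hrd | hdr := lt_or_ge r d
  · simp [Nat.descFactorial_of_lt hrd]
  obtain ⟨t', htt', ht'⟩ := exists_superset_card_eq ht hd
  have hcard : (Fintype.card ι - d).choose (r - d) ≤
      #{S ∈ powersetCard r (univ : Finset ι) | t ⊆ S} := by
    rw [← ht', ← card_compl, ← card_powersetCard]
    refine card_le_card_of_injOn (· ∪ t') (fun U hU => ?_) fun U hU V hV h => ?_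
    · obtain ⟨h1, h2⟩ := mem_powersetCard.1 hU
      have hdis : Disjoint U t' := (subset_compl_iff_disjoint_right).1 h1
      simp only [coe_filter, mem_powersetCard, subset_univ, true_and, Set.mem_ofPred_eq]
      exact ⟨by rw [card_union_of_disjoint hdis]; omega, htt'.trans subset_union_right⟩
    · have hU' : Disjoint U t' := (subset_compl_iff_disjoint_right).1 (mem_powersetCard.1 hU).1
      have hV' : Disjoint V t' := (subset_compl_iff_disjoint_right).1 (mem_powersetCard.1 hV).1
      have := congrArg (· \ t') h
      simpa [union_sdiff_distrib, hU'.sdiff_eq_left, hV'.sdiff_eq_left] using this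
  calc _ = d.factorial * ((Fintype.card ι).choose r * r.choose d) := by
        rw [Nat.descFactorial_eq_factorial_mul_choose]; ring
    _ = (Fintype.card ι).descFactorial d * (Fintype.card ι - d).choose (r - d) := by
        rw [Nat.choose_mul hdr, Nat.descFactorial_eq_factorial_mul_choose]; ring
    _ ≤ _ := Nat.mul_le_mul_left _ hcard

/-- Averaging over all `r`-subsets of `ι` (sampling without replacement). -/
lemma le_of_forall_powersetCard_sum_ge {ι : Type*} [Fintype ι] [DecidableEq ι] {r d : ℕ}
    (hrm : r ≤ Fintype.card ι) (hd : d ≤ Fintype.card ι) (G : (Fin d → ι) → ℝ)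
    {A B : ℝ} (hB : ∀ g, G g ≤ B)
    (hA : ∀ S : Finset ι, #S = r → (r : ℝ) ^ d * A ≤ ∑ g ∈ Fintype.piFinset fun _ => S, G g) :
    (r.descFactorial d : ℝ) * ((Fintype.card ι : ℝ) ^ d * B - ∑ g, G g) ≤
      (r : ℝ) ^ d * ((Fintype.card ι).descFactorial d) * (B - A) := by
  set m := Fintype.card ι with hm
  have hN : (0 : ℝ) < m.choose r := by exact_mod_cast Nat.choose_pos hrm
  have hsum : ∑ g, (B - G g) = (m : ℝ) ^ d * B - ∑ g, G g := by
    simp [sum_sub_distrib, ← hm]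
  have h1 : ∑ S ∈ powersetCard r (univ : Finset ι), ∑ g ∈ Fintype.piFinset fun _ : Fin d => S,
      (B - G g) ≤ m.choose r * ((r : ℝ) ^ d * (B - A)) := by
    have : (m.choose r : ℝ) = #(powersetCard r (univ : Finset ι)) := by
      rw [card_powersetCard, card_univ]
    rw [this, ← nsmul_eq_mul]
    refine sum_le_card_nsmul _ _ _ fun S hS => ?_
    have hSr := (mem_powersetCard.1 hS).2
    have := hA S hSr
    rw [sum_sub_distrib, sum_const, Fintype.card_piFinset, prod_const, card_univ,
      Fintype.card_fin, hSr, nsmul_eq_mul]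
    push_cast
    linarith
  have h2 : ∑ S ∈ powersetCard r (univ : Finset ι), ∑ g ∈ Fintype.piFinset fun _ : Fin d => S,
      (B - G g) =
      ∑ g, (#{S ∈ powersetCard r (univ : Finset ι) | univ.image g ⊆ S} : ℝ) * (B - G g) := by
    have (S : Finset ι) : ∑ g ∈ Fintype.piFinset fun _ : Fin d => S, (B - G g) =
        ∑ g, if univ.image g ⊆ S then (B - G g) else 0 := by
      rw [← sum_filter]
      congr 1
      ext g
      simp [Fintype.mem_piFinset, subset_iff]
    simp only [this]
    rw [sum_comm]
    refine sum_congr rfl fun g _ => ?_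
    rw [← sum_filter, sum_const, nsmul_eq_mul]
  have h3 : (r.descFactorial d : ℝ) * m.choose r * ∑ g, (B - G g) ≤
      m.descFactorial d * (m.choose r * ((r : ℝ) ^ d * (B - A))) := by
    refine le_trans ?_ (mul_le_mul_of_nonneg_left h1 (by positivity))
    rw [h2, mul_sum, mul_sum]
    refine sum_le_sum fun g _ => ?_
    rw [← mul_assoc]
    refine mul_le_mul_of_nonneg_right ?_ (sub_nonneg.2 (hB g))
    exact_mod_cast descFactorial_mul_choose_le_card_filter hd
      (card_image_le.trans_eq (by simp) : #(univ.image g) ≤ d)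
  rw [← hsum]
  refine le_of_mul_le_mul_left ?_ hN
  linarith

lemma descFactorial_mul_pow_le {r m d : ℕ} (hrm : r ≤ m) (hd : d ≤ m) :
    (r.descFactorial d : ℝ) * (m : ℝ) ^ d ≤ (r : ℝ) ^ d * m.descFactorial d := by
  have h := le_of_forall_powersetCard_sum_ge (ι := Fin m) (r := r) (d := d) (by simpa) (by simpa)
    (fun _ => 0) (A := 0) (B := 1) (by simp) (by simp)
  simpa using h

lemma exists_countVec_eq {n m : ℕ} {x : Fin n → ℝ} (hx : x ∈ gridSet n m) :
    ∃ c : Fin m → Fin n, (m : ℝ) • x = countVec c univ := by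
  obtain ⟨⟨-, hx1⟩, hk⟩ := hx
  choose k hk using hk
  have hsum : ∑ j, k j = m := by
    have : ((∑ j, k j : ℕ) : ℝ) = m := by
      push_cast
      simp only [← hk]
      rw [← mul_sum, hx1, mul_one]
    exact_mod_cast this
  subst hsum
  refine ⟨fun b => (finSigmaFinEquiv.symm b).1, ?_⟩
  ext j
  rw [Pi.smul_apply, smul_eq_mul, hk, countVec,
    Equiv.sum_comp finSigmaFinEquiv.symm fun b => if b.1 = j then (1 : ℝ) else 0,
    Fintype.sum_sigma, sum_eq_single j (fun a _ ha => by simp [ha]) (by simp)]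
  simp

/-- Theorem 4.1: for a homogeneous polynomial `f` of degree `d` and integers
`1 ≤ r ≤ m` with `m ≥ d`, one has
`f_{Δ(n,r)} − f_{Δ(n,m)} ≤ (1 − r^{\underline d} m^d/(r^d m^{\underline d})) C(2d−1,d) d^d (\overline f − \underline f)`. -/
theorem grid_min_diff_le_of_homogeneous (n d : ℕ) (p : MvPolynomial (Fin n) ℝ)
    (hp : p.IsHomogeneous d) (r m : ℕ) (hr : 1 ≤ r) (hrm : r ≤ m) (hm : d ≤ m) :
    gridMin n r (fun x => MvPolynomial.eval x p) -
        gridMin n m (fun x => MvPolynomial.eval x p) ≤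
      (1 - (r.descFactorial d : ℝ) * (m : ℝ) ^ d /
            ((r : ℝ) ^ d * (m.descFactorial d : ℝ))) *
        ((2 * d - 1).choose d : ℝ) * (d : ℝ) ^ d *
        (simplexMax n (fun x => MvPolynomial.eval x p) -
          simplexMin n (fun x => MvPolynomial.eval x p)) := by
  obtain rfl | hn := Nat.eq_zero_or_pos n
  · have h : stdSimplex ℝ (Fin 0) = ∅ := by
      ext x
      simp [stdSimplex]
    simp [gridMin, simplexMax, simplexMin, gridSet, h]
  have : NeZero n := ⟨hn.ne'⟩
  obtain ⟨T, hT⟩ := exists_tensorForm_eq_eval hp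
  simp only [hT]
  have hcont : Continuous (tensorForm T) := by
    unfold tensorForm
    fun_prop
  have hcpt := (isCompact_stdSimplex (𝕜 := ℝ) (ι := Fin n)).image hcont
  set L := simplexMin n fun x => tensorForm T x
  set M := simplexMax n fun x => tensorForm T x
  have hL (x) (hx : x ∈ stdSimplex ℝ (Fin n)) : L ≤ tensorForm T x :=
    csInf_le hcpt.bddBelow (Set.mem_image_of_mem _ hx)
  have hM (x) (hx : x ∈ stdSimplex ℝ (Fin n)) : tensorForm T x ≤ M :=
    le_csSup hcpt.bddAbove (Set.mem_image_of_mem _ hx)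
  have hgrid (x) (hx : x ∈ gridSet n r) :
      gridMin n r (fun x => tensorForm T x) ≤ tensorForm T x :=
    csInf_le (hcpt.bddBelow.mono (Set.image_mono fun _ h => h.1)) (Set.mem_image_of_mem _ hx)
  have hr0 : (0 : ℝ) < r := by exact_mod_cast hr
  have hm0 : (0 : ℝ) < m := by exact_mod_cast hr.trans hrm
  have hdf : (0 : ℝ) < m.descFactorial d := by exact_mod_cast Nat.descFactorial_pos.2 hm
  set A := gridMin n r fun x => tensorForm T x
  have hne : (gridSet n m).Nonempty := by
    have h := inv_smul_countVec_mem_gridSet (fun _ : Fin m => (0 : Fin n)) (S := univ)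
      (card_pos.1 (by rw [card_univ, Fintype.card_fin]; exact hr.trans hrm))
    rw [card_univ, Fintype.card_fin] at h
    exact ⟨_, h⟩
  rw [sub_le_iff_le_add, ← sub_le_iff_le_add']
  refine le_csInf (hne.image _) ?_
  rintro _ ⟨x, hx, rfl⟩
  rw [sub_le_iff_le_add', ← sub_le_iff_le_add]
  obtain ⟨c, hc⟩ := exists_countVec_eq hx
  set T' : (Fin d → Fin n) → ℝ :=
    fun i => (d.factorial : ℝ)⁻¹ * ∑ σ : Equiv.Perm (Fin d), T (i ∘ σ) with hT'
  set C : ℝ := ((2 * d - 1).choose d : ℝ) * (d : ℝ) ^ d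
  set w : ℝ := (r.descFactorial d : ℝ) * (m : ℝ) ^ d / ((r : ℝ) ^ d * (m.descFactorial d : ℝ))
    with hw
  have hw1 : w ≤ 1 := (div_le_one (by positivity)).2 (descFactorial_mul_pow_le hrm hm)
  have hB (i) : T' i ≤ L + C * (M - L) := by
    obtain rfl | hd := Nat.eq_zero_or_pos d
    · have h1 := hL x hx.1
      have h2 := hM x hx.1
      have h3 : T' i = tensorForm T x := by
        rw [← tensorForm_symmetrize T x, ← hT']
        simp [tensorForm]
        exact congrArg T' (Subsingleton.elim _ _)
      rw [h3]
      simp only [C, pow_zero, Nat.choose_zero_right, Nat.cast_one]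
      linarith
    · have h := sum_perm_le_of_nonneg_of_le hd (fun i => T i - L) (M := M - L)
        (fun y hy => by rw [tensorForm_sub_const, hy.2, one_pow]; linarith [hL y hy])
        (fun y hy => by rw [tensorForm_sub_const, hy.2, one_pow]; linarith [hM y hy]) i
      rw [sum_sub_distrib, sum_const, card_univ, Fintype.card_perm, Fintype.card_fin,
        nsmul_eq_mul] at h
      have hf : (0 : ℝ) < d.factorial := by positivity
      rw [hT', inv_mul_le_iff₀ hf]
      linarith
  have hx' : (m : ℝ) ^ d * tensorForm T x = ∑ g : Fin d → Fin m, T' (c ∘ g) := by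
    rw [← tensorForm_smul, hc, ← tensorForm_symmetrize, tensorForm_countVec,
      Fintype.piFinset_univ]
  have key := le_of_forall_powersetCard_sum_ge (ι := Fin m) (r := r) (by simpa) (by simpa)
    (fun g : Fin d → Fin m => T' (c ∘ g)) (A := A) (fun g => hB (c ∘ g)) (by
      intro S hS
      have hne : S.Nonempty := card_pos.1 (by omega)
      have hmem := inv_smul_countVec_mem_gridSet c hne
      rw [hS] at hmem
      rw [← tensorForm_countVec, tensorForm_symmetrize]
      have h := mul_le_mul_of_nonneg_left (hgrid _ hmem) (by positivity : 0 ≤ (r : ℝ) ^ d)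
      rwa [← tensorForm_smul, smul_inv_smul₀ hr0.ne'] at h)
  rw [← hx', Fintype.card_fin, ← mul_sub, ← mul_assoc, ← div_le_iff₀' (by positivity),
    mul_div_right_comm, ← hw] at key
  have hfin : (1 - w) * L ≤ (1 - w) * tensorForm T x :=
    mul_le_mul_of_nonneg_left (hL x hx.1) (by linarith)
  have hC : (1 - w) * ((2 * d - 1).choose d : ℝ) * (d : ℝ) ^ d * (M - L) =
      (1 - w) * (C * (M - L)) := by
    simp only [C]
    ring
  rw [hC]
  linarith
end

section
/- Let m_1, …, m_n be nonnegative integers with Σ_{i=1}^n m_i = m, let r be an integer with 1 ≤ r ≤ m, and let β ∈ ℕ^n. Then the β-th moment of the multivariate hypergeometric distribution satisfies: Σ_{α ∈ I(n,r)} α^β · (∏_{i=1}^n C(m_i, α_i)) / C(m, r) = Σ_{α ∈ ℕ^n, α ≤ β} (r^{\underline{|α|}} / m^{\underline{|α|}}) · (∏_{i=1}^n m_i^{\underline{α_i}}) · (∏_{i=1}^n S(β_i, α_i)), provided every |α| ≤ |β| occurring on the right satisfies m^{\underline{|α|}} ≠ 0 (which holds when m ≥ |β|). -/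
open Finset

/-- Stirling numbers of the second kind: `stirling2 a b` counts the partitions of a
set of `a` objects into `b` nonempty subsets. -/
def stirling2 : ℕ → ℕ → ℕ
  | 0, 0 => 1
  | 0, _ + 1 => 0
  | _ + 1, 0 => 0
  | a + 1, b + 1 => (b + 1) * stirling2 a (b + 1) + stirling2 a b

theorem stirling2_eq_stirlingSecond : ∀ a b, stirling2 a b = Nat.stirlingSecond a b
  | 0, 0 => rfl
  | 0, _ + 1 => rfl
  | _ + 1, 0 => rfl
  | a + 1, b + 1 => by
    rw [stirling2, Nat.stirlingSecond_succ_succ, stirling2_eq_stirlingSecond a (b + 1),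
      stirling2_eq_stirlingSecond a b]

theorem mul_descFactorial_eq (x k : ℕ) :
    x * x.descFactorial k = x.descFactorial (k + 1) + k * x.descFactorial k := by
  rw [Nat.descFactorial_succ, ← add_mul]
  rcases le_or_gt k x with h | h
  · rw [Nat.sub_add_cancel h]
  · simp [Nat.descFactorial_of_lt h]

/-- Powers expand in falling factorials with Stirling numbers of the second kind. -/
theorem pow_eq_sum_descFactorial_mul_stirling2 (x b : ℕ) :
    x ^ b = ∑ k ∈ Iic b, x.descFactorial k * stirling2 b k := by
  have hIic : ∀ c : ℕ, Iic c = range (c + 1) := fun c => by ext; simp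
  simp only [hIic]
  induction b with
  | zero => simp [stirling2]
  | succ b ih =>
    have hlast : stirling2 b (b + 1) = 0 := by
      rw [stirling2_eq_stirlingSecond, Nat.stirlingSecond_eq_zero_of_lt (Nat.lt_succ_self b)]
    have hshift : ∑ k ∈ range (b + 1), x.descFactorial (k + 1) * ((k + 1) * stirling2 b (k + 1))
        = ∑ k ∈ range (b + 1), x.descFactorial k * (k * stirling2 b k) := by
      have h₁ := sum_range_succ' (fun k => x.descFactorial k * (k * stirling2 b k)) (b + 1)
      have h₂ := sum_range_succ (fun k => x.descFactorial k * (k * stirling2 b k)) (b + 1)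
      simp only [hlast, mul_zero, zero_mul, add_zero] at h₁ h₂
      rw [← h₁, h₂]
    rw [sum_range_succ']
    simp only [stirling2, mul_zero, add_zero, mul_add, sum_add_distrib]
    rw [hshift, ← sum_add_distrib, pow_succ', ih, mul_sum]
    refine sum_congr rfl fun k _ => ?_
    rw [← mul_assoc, mul_descFactorial_eq]
    ring

open Polynomial in
theorem Polynomial.coeff_prod_eq_sum_antidiagonalTuple {R : Type*} [CommSemiring R] {n : ℕ}
    (p : Fin n → R[X]) (r : ℕ) :
    (∏ i, p i).coeff r = ∑ α ∈ Finset.Nat.antidiagonalTuple n r, ∏ i, (p i).coeff (α i) := by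
  have h := PowerSeries.coeff_prod (fun i => (p i : PowerSeries R)) r univ
  simp only [Polynomial.coeff_coe] at h
  rw [← Polynomial.coeff_coe, ← Polynomial.coeToPowerSeries.ringHom_apply, map_prod]
  simp only [Polynomial.coeToPowerSeries.ringHom_apply]
  rw [h]
  refine sum_equiv Finsupp.equivFunOnFinite (fun l => ?_) (fun l _ => rfl)
  simp [Finset.Nat.mem_antidiagonalTuple, mem_finsuppAntidiag]

open Polynomial in
theorem choose_mul_descFactorial_eq_coeff (m a k : ℕ) :
    a.descFactorial k * m.choose a =
      (C (m.descFactorial k) * (X ^ k * (1 + X) ^ (m - k)) : ℕ[X]).coeff a := by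
  rw [coeff_C_mul, coeff_X_pow_mul', add_comm (1 : ℕ[X]), coeff_X_add_one_pow]
  split_ifs with h
  · have := Nat.choose_mul (n := m) h
    rw [Nat.descFactorial_eq_factorial_mul_choose, Nat.descFactorial_eq_factorial_mul_choose,
      mul_assoc, mul_assoc, mul_comm (a.choose k), this]
    simp
  · simp [Nat.descFactorial_of_lt (not_le.mp h)]

open Polynomial in
/-- Factorial moments of the multivariate hypergeometric distribution, cleared of denominators. -/
theorem descFactorial_mul_sum_antidiagonalTuple {n : ℕ} (μ γ : Fin n → ℕ) (r : ℕ) :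
    (∑ i, μ i).descFactorial (∑ i, γ i) *
        ∑ α ∈ Finset.Nat.antidiagonalTuple n r,
          ∏ i, ((α i).descFactorial (γ i) * (μ i).choose (α i)) =
      r.descFactorial (∑ i, γ i) * (∑ i, μ i).choose r * ∏ i, (μ i).descFactorial (γ i) := by
  simp only [choose_mul_descFactorial_eq_coeff]
  rw [← Polynomial.coeff_prod_eq_sum_antidiagonalTuple, prod_mul_distrib, ← map_prod,
    coeff_C_mul, coeff_C_mul]
  by_cases h : ∀ i, γ i ≤ μ i
  · rw [prod_mul_distrib, prod_pow_eq_pow_sum, prod_pow_eq_pow_sum,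
      sum_tsub_distrib _ fun i _ => h i]
    ring
  · push Not at h
    obtain ⟨i, hi⟩ := h
    have hzero : ∏ i, (μ i).descFactorial (γ i) = 0 :=
      prod_eq_zero (mem_univ i) (Nat.descFactorial_of_lt hi)
    simp only [hzero, zero_mul, mul_zero]

/-- Corollary 1.5 (moments of the multivariate hypergeometric distribution):
`E[∏ Yᵢ^{βᵢ}] = Σ_{α ≤ β} (r^{\underline{|α|}}/m^{\underline{|α|}}) ∏ mᵢ^{\underline{αᵢ}} ∏ S(βᵢ,αᵢ)`,
where `Pr[Y = α] = ∏ C(mᵢ,αᵢ)/C(m,r)` on `I(n,r)`, provided `m ≥ |β|` so that all the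
falling factorials `m^{\underline{|α|}}` appearing on the right are nonzero. -/
theorem hypergeometric_moment (n : ℕ) (mvec : Fin n → ℕ) (m : ℕ)
    (hmvec : ∑ i, mvec i = m) (r : ℕ) (hr : 1 ≤ r) (hrm : r ≤ m)
    (β : Fin n → ℕ) (hβ : ∑ i, β i ≤ m) :
    ∑ α ∈ Finset.Nat.antidiagonalTuple n r,
        (∏ i, ((α i : ℝ)) ^ β i) *
          (∏ i, ((mvec i).choose (α i) : ℝ)) / (m.choose r : ℝ)
      = ∑ α ∈ Finset.Iic β,
          (r.descFactorial (∑ i, α i) : ℝ) / (m.descFactorial (∑ i, α i) : ℝ) *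
            (∏ i, ((mvec i).descFactorial (α i) : ℝ)) *
            ∏ i, (stirling2 (β i) (α i) : ℝ) := by
  have hIic : Iic β = Fintype.piFinset fun i => Iic (β i) := by
    ext α
    simp [Pi.le_def]
  have hexpand : ∀ α : Fin n → ℕ, (∏ i, (α i : ℝ) ^ β i) * ∏ i, ((mvec i).choose (α i) : ℝ) =
      ∑ γ ∈ Iic β, ((∏ i, ((α i).descFactorial (γ i) * (mvec i).choose (α i)) : ℕ) : ℝ) *
        ∏ i, (stirling2 (β i) (γ i) : ℝ) := by
    intro α
    have hpow : ∏ i, (α i : ℝ) ^ β i = ((∏ i, α i ^ β i : ℕ) : ℝ) := by push_cast; rfl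
    rw [hpow, prod_congr rfl fun i _ => pow_eq_sum_descFactorial_mul_stirling2 (α i) (β i),
      prod_univ_sum, ← hIic]
    push_cast
    rw [sum_mul]
    refine sum_congr rfl fun γ _ => ?_
    simp only [prod_mul_distrib]
    ring
  simp only [hexpand, sum_div]
  rw [sum_comm]
  refine sum_congr rfl fun γ hγ => ?_
  have hγm : ∑ i, γ i ≤ m := (sum_le_sum fun i _ => mem_Iic.mp hγ i).trans hβ
  have hdesc : (m.descFactorial (∑ i, γ i) : ℝ) ≠ 0 :=
    Nat.cast_ne_zero.mpr (Nat.descFactorial_eq_zero_iff_lt.not.mpr hγm.not_gt)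
  have hchoose : (m.choose r : ℝ) ≠ 0 := Nat.cast_ne_zero.mpr (Nat.choose_pos hrm).ne'
  have key := congrArg (Nat.cast (R := ℝ)) (descFactorial_mul_sum_antidiagonalTuple mvec γ r)
  rw [hmvec, Nat.cast_mul, Nat.cast_mul, Nat.cast_mul, Nat.cast_sum, Nat.cast_prod] at key
  rw [← sum_div, ← sum_mul]
  field_simp
  linear_combination (∏ i, (stirling2 (β i) (γ i) : ℝ)) * key
end
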